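/- For every vertex v with μ(v) = −1, the A-partner of v is different from the B-partner of v; consequently, every vertex v with μ(v) = −1 has degree exactly 2 in the graph G(μ). -/

import Mathlib

open Finset

/-- The open counterclockwise arc `{v+1, …, v+(k-1)}` (indexed by `i = 1,…,k-1`) is
balanced: it contains as many elements where `μ = 1` as elements where `μ = -1`. -/
def ArcBalanced (n : ℕ) (μ : ZMod (2*n+1) → ℤ) (v : ZMod (2*n+1)) (k : ℕ) : Prop :=
  ((Finset.Icc 1 (k-1)).filter fun i : ℕ => μ (v + (i : ZMod (2*n+1))) = 1).card =
  ((Finset.Icc 1 (k-1)).filter fun i : ℕ => μ (v + (i : ZMod (2*n+1))) = -1).card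

/-- `k` is a valid cancellation length for an `A`-band at `v`:
`μ (v+k) = 1` and the open arc `{v+1, …, v+(k-1)}` is balanced. -/
def AGood (n : ℕ) (μ : ZMod (2*n+1) → ℤ) (v : ZMod (2*n+1)) (k : ℕ) : Prop :=
  μ (v + (k : ZMod (2*n+1))) = 1 ∧ ArcBalanced n μ v k

/-- `k` is a valid cancellation length for a `B`-band at `v`:
`μ (v-k) = 1` and the open arc `{v-k+1, …, v-1}` is balanced. -/
def BGood (n : ℕ) (μ : ZMod (2*n+1) → ℤ) (v : ZMod (2*n+1)) (k : ℕ) : Prop :=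
  μ (v - (k : ZMod (2*n+1))) = 1 ∧ ArcBalanced n μ (v - (k : ZMod (2*n+1))) k

/-- `w` is the `A`-partner of `v`: `w = v + k` for the least `k ∈ {1,…,2n}` with
`μ (v+k) = 1` and the open arc `{v+1,…,v+(k-1)}` balanced. -/
def IsAPartner (n : ℕ) (μ : ZMod (2*n+1) → ℤ) (v w : ZMod (2*n+1)) : Prop :=
  ∃ k ∈ Finset.Icc 1 (2*n), AGood n μ v k ∧
    (∀ j ∈ Finset.Icc 1 (2*n), j < k → ¬ AGood n μ v j) ∧ w = v + (k : ZMod (2*n+1))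

/-- `w` is the `B`-partner of `v`: `w = v - k` for the least `k ∈ {1,…,2n}` with
`μ (v-k) = 1` and the open arc `{v-k+1,…,v-1}` balanced. -/
def IsBPartner (n : ℕ) (μ : ZMod (2*n+1) → ℤ) (v w : ZMod (2*n+1)) : Prop :=
  ∃ k ∈ Finset.Icc 1 (2*n), BGood n μ v k ∧
    (∀ j ∈ Finset.Icc 1 (2*n), j < k → ¬ BGood n μ v j) ∧ w = v - (k : ZMod (2*n+1))

/-- The auxiliary graph `G(μ)`: its edges are exactly the unordered pairs
`{v, A-partner of v}` and `{v, B-partner of v}` over all `v` with `μ v = -1`. -/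
def G (n : ℕ) (μ : ZMod (2*n+1) → ℤ) : SimpleGraph (ZMod (2*n+1)) :=
  SimpleGraph.fromRel fun x y => μ x = -1 ∧ (IsAPartner n μ x y ∨ IsBPartner n μ x y)

noncomputable instance {n : ℕ} {μ : ZMod (2*n+1) → ℤ} {v : ZMod (2*n+1)} :
    Fintype ((G n μ).neighborSet v) := Fintype.ofFinite _

theorem sum_eq_card_filter_sub {ι : Type*} (s : Finset ι) (f : ι → ℤ)
    (hf : ∀ i, f i = 1 ∨ f i = -1) :
    ∑ i ∈ s, f i = ((s.filter fun i => f i = 1).card : ℤ) - (s.filter fun i => f i = -1).card := by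
  classical
  induction s using Finset.induction_on with
  | empty => simp
  | insert a s ha ih =>
    rw [Finset.sum_insert ha, ih, Finset.filter_insert, Finset.filter_insert]
    rcases hf a with h | h <;> simp [h, ha] <;> ring

theorem exists_eq_one_sum_range_eq_neg_one {f : ℕ → ℤ} (hf : ∀ i, f i = 1 ∨ f i = -1)
    (h0 : f 0 = -1) {N : ℕ} (hN : ∑ i ∈ range (N + 1), f i = 1) :
    ∃ k ∈ Finset.Icc 1 N, f k = 1 ∧ ∑ i ∈ range k, f i = -1 := by
  classical
  have hex : ∃ m, 0 ≤ ∑ i ∈ range (m + 1), f i := ⟨N, by omega⟩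
  have hk := Nat.find_spec hex
  have hle : Nat.find hex ≤ N := Nat.find_le (by omega)
  have hlt : ∀ m < Nat.find hex, ∑ i ∈ range (m + 1), f i < 0 := fun m hm =>
    not_le.mp (Nat.find_min hex hm)
  generalize Nat.find hex = k at hk hle hlt
  obtain _ | k := k
  · simp [h0] at hk
  · have h1 := hlt k (by omega)
    rw [Finset.sum_range_succ] at hk
    exact ⟨k + 1, Finset.mem_Icc.mpr ⟨by omega, hle⟩, by grind, by grind⟩

theorem arcBalanced_iff_sum_range {n : ℕ} {μ : ZMod (2*n+1) → ℤ} (hval : ∀ v, μ v = 1 ∨ μ v = -1)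
    (v : ZMod (2*n+1)) {k : ℕ} (hk : 1 ≤ k) :
    ArcBalanced n μ v k ↔ ∑ i ∈ range k, μ (v + (i : ZMod (2*n+1))) = μ v := by
  have harc := sum_eq_card_filter_sub (Finset.Icc 1 (k - 1))
    (fun i : ℕ => μ (v + (i : ZMod (2*n+1)))) fun i => hval _
  have hrange : range k = insert 0 (Finset.Icc 1 (k - 1)) := by
    ext i
    simp only [Finset.mem_range, Finset.mem_insert, Finset.mem_Icc]
    omega
  rw [hrange, Finset.sum_insert (by simp), harc, ArcBalanced]
  simp only [Nat.cast_zero, add_zero]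
  omega

theorem sum_range_add_natCast {m : ℕ} [NeZero m] (μ : ZMod m → ℤ) (v : ZMod m) :
    ∑ i ∈ range m, μ (v + (i : ZMod m)) = ∑ x, μ x := by
  refine Finset.sum_nbij' (fun i => v + (i : ZMod m)) (fun x => (x - v).val) ?_ ?_ ?_ ?_ ?_
  · simp
  · intro x _
    simpa using ZMod.val_lt (x - v)
  · intro i hi
    simpa using ZMod.val_cast_of_lt (Finset.mem_range.mp hi)
  · intro x _
    simp
  · simp

theorem sum_range_sub_natCast {m : ℕ} (μ : ZMod m → ℤ) (v : ZMod m) (k : ℕ) :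
    ∑ i ∈ range (k + 1), μ (v - (i : ZMod m)) =
      ∑ i ∈ range (k + 1), μ (v - (k : ZMod m) + (i : ZMod m)) := by
  rw [← Finset.sum_range_reflect]
  refine Finset.sum_congr rfl fun i hi => ?_
  have hik : i ≤ k := Nat.lt_succ_iff.mp (Finset.mem_range.mp hi)
  rw [Nat.add_sub_cancel, Nat.cast_sub hik]
  congr 1
  ring

theorem IsAPartner.unique {n : ℕ} {μ : ZMod (2*n+1) → ℤ} {v w w' : ZMod (2*n+1)}
    (h : IsAPartner n μ v w) (h' : IsAPartner n μ v w') : w = w' := by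
  obtain ⟨k, hk, hg, hmin, rfl⟩ := h
  obtain ⟨j, hj, hg', hmin', rfl⟩ := h'
  rcases lt_trichotomy k j with hlt | rfl | hlt
  · exact absurd hg (hmin' k hk hlt)
  · rfl
  · exact absurd hg' (hmin j hj hlt)

theorem IsBPartner.unique {n : ℕ} {μ : ZMod (2*n+1) → ℤ} {v w w' : ZMod (2*n+1)}
    (h : IsBPartner n μ v w) (h' : IsBPartner n μ v w') : w = w' := by
  obtain ⟨k, hk, hg, hmin, rfl⟩ := h
  obtain ⟨j, hj, hg', hmin', rfl⟩ := h'
  rcases lt_trichotomy k j with hlt | rfl | hlt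
  · exact absurd hg (hmin' k hk hlt)
  · rfl
  · exact absurd hg' (hmin j hj hlt)

theorem IsAPartner.apply_eq_one {n : ℕ} {μ : ZMod (2*n+1) → ℤ} {v w : ZMod (2*n+1)}
    (h : IsAPartner n μ v w) : μ w = 1 := by
  obtain ⟨k, _, hg, _, rfl⟩ := h
  exact hg.1

theorem IsBPartner.apply_eq_one {n : ℕ} {μ : ZMod (2*n+1) → ℤ} {v w : ZMod (2*n+1)}
    (h : IsBPartner n μ v w) : μ w = 1 := by
  obtain ⟨k, _, hg, _, rfl⟩ := h
  exact hg.1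

theorem exists_minimal_mem {s : Finset ℕ} {P : ℕ → Prop} (h : ∃ k ∈ s, P k) :
    ∃ k ∈ s, P k ∧ ∀ j ∈ s, j < k → ¬ P j := by
  classical
  obtain ⟨hk, hP⟩ := Nat.find_spec h
  exact ⟨Nat.find h, hk, hP, fun j hj hlt hPj => Nat.find_min h hlt ⟨hj, hPj⟩⟩

theorem exists_isAPartner {n : ℕ} {μ : ZMod (2*n+1) → ℤ} (hval : ∀ v, μ v = 1 ∨ μ v = -1)
    (hsum : ∑ x, μ x = 1) {v : ZMod (2*n+1)} (hv : μ v = -1) : ∃ w, IsAPartner n μ v w := by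
  obtain ⟨k, hk, hone, hneg⟩ := exists_eq_one_sum_range_eq_neg_one
    (f := fun i : ℕ => μ (v + (i : ZMod (2*n+1)))) (fun _ => hval _) (by simpa using hv)
    ((sum_range_add_natCast μ v).trans hsum)
  obtain ⟨j, hj, hg, hmin⟩ := exists_minimal_mem (P := AGood n μ v) ⟨k, hk, hone,
    (arcBalanced_iff_sum_range hval v (Finset.mem_Icc.mp hk).1).mpr (hneg.trans hv.symm)⟩
  exact ⟨_, j, hj, hg, hmin, rfl⟩

theorem exists_isBPartner {n : ℕ} {μ : ZMod (2*n+1) → ℤ} (hval : ∀ v, μ v = 1 ∨ μ v = -1)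
    (hsum : ∑ x, μ x = 1) {v : ZMod (2*n+1)} (hv : μ v = -1) : ∃ w, IsBPartner n μ v w := by
  obtain ⟨k, hk, hone, hneg⟩ := exists_eq_one_sum_range_eq_neg_one
    (f := fun i : ℕ => μ (v - (i : ZMod (2*n+1)))) (fun _ => hval _) (by simpa using hv)
    ((sum_range_sub_natCast μ v (2*n)).trans ((sum_range_add_natCast μ _).trans hsum))
  have hbal : ArcBalanced n μ (v - (k : ZMod (2*n+1))) k := by
    rw [arcBalanced_iff_sum_range hval _ (Finset.mem_Icc.mp hk).1]
    have hrefl := sum_range_sub_natCast μ v k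
    rw [Finset.sum_range_succ, Finset.sum_range_succ, sub_add_cancel, hv] at hrefl
    linarith
  obtain ⟨j, hj, hg, hmin⟩ := exists_minimal_mem (P := BGood n μ v) ⟨k, hk, hone, hbal⟩
  exact ⟨_, j, hj, hg, hmin, rfl⟩

theorem IsAPartner.ne_of_isBPartner {n : ℕ} {μ : ZMod (2*n+1) → ℤ}
    (hval : ∀ v, μ v = 1 ∨ μ v = -1) (hsum : ∑ x, μ x = 1) {v w w' : ZMod (2*n+1)}
    (hv : μ v = -1) (hA : IsAPartner n μ v w) (hB : IsBPartner n μ v w') : w ≠ w' := by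
  obtain ⟨k, hk, ⟨hone, hbal⟩, -, rfl⟩ := hA
  obtain ⟨j, hj, ⟨-, hbal'⟩, -, rfl⟩ := hB
  intro heq
  rw [Finset.mem_Icc] at hk hj
  have hcast : ((k + j : ℕ) : ZMod (2*n+1)) = 0 := by
    push_cast
    linear_combination heq
  have hkj : k + j = 2*n+1 := by
    obtain ⟨c, hc⟩ := (ZMod.natCast_eq_zero_iff _ _).mp hcast
    obtain _ | _ | c := c
    · omega
    · omega
    · nlinarith
  rw [← heq] at hbal'
  rw [arcBalanced_iff_sum_range hval _ hk.1] at hbal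
  rw [arcBalanced_iff_sum_range hval _ hj.1] at hbal'
  have htotal : ∑ i ∈ range (k + j), μ (v + (i : ZMod (2*n+1))) = 1 := by
    rw [hkj]
    exact (sum_range_add_natCast μ v).trans hsum
  rw [Finset.sum_range_add] at htotal
  simp only [Nat.cast_add, ← add_assoc] at htotal
  rw [hbal, hbal'] at htotal
  omega

theorem aPartner_ne_bPartner_degree_two (n : ℕ) (μ : ZMod (2*n+1) → ℤ)
    (hn : 0 < n)
    (hval : ∀ v, μ v = 1 ∨ μ v = -1)
    (hplus : (Finset.univ.filter fun v : ZMod (2*n+1) => μ v = 1).card = n + 1)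
    (hminus : (Finset.univ.filter fun v : ZMod (2*n+1) => μ v = -1).card = n) :
    (∀ v w w' : ZMod (2*n+1), μ v = -1 → IsAPartner n μ v w → IsBPartner n μ v w' → w ≠ w') ∧
    (∀ v : ZMod (2*n+1), μ v = -1 → (G n μ).degree v = 2) := by
  have hsum : ∑ x, μ x = 1 := by
    rw [sum_eq_card_filter_sub _ μ hval, hplus, hminus]
    push_cast
    ring
  refine ⟨fun v w w' hv hA hB => hA.ne_of_isBPartner hval hsum hv hB, fun v hv => ?_⟩
  obtain ⟨w, hw⟩ := exists_isAPartner hval hsum hv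
  obtain ⟨w', hw'⟩ := exists_isBPartner hval hsum hv
  have hnbr : (G n μ).neighborFinset v = {w, w'} := by
    ext x
    rw [SimpleGraph.mem_neighborFinset, G, SimpleGraph.fromRel_adj, Finset.mem_insert,
      Finset.mem_singleton]
    constructor
    · rintro ⟨-, ⟨-, h | h⟩ | ⟨-, h | h⟩⟩
      · exact Or.inl (h.unique hw)
      · exact Or.inr (h.unique hw')
      · have := h.apply_eq_one
        omega
      · have := h.apply_eq_one
        omega
    · rintro (rfl | rfl)
      · refine ⟨?_, Or.inl ⟨hv, Or.inl hw⟩⟩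
        rintro rfl
        have := hw.apply_eq_one
        omega
      · refine ⟨?_, Or.inl ⟨hv, Or.inr hw'⟩⟩
        rintro rfl
        have := hw'.apply_eq_one
        omega
  rw [← SimpleGraph.card_neighborFinset_eq_degree, hnbr,
    Finset.card_pair (hw.ne_of_isBPartner hval hsum hv hw')]
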